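/- arXiv:math/0411089 — 4 statements merged into one kernel-verified Lean document; each statement's English description precedes it below -/
import Mathlib

section
/- Let q ≥ 2 and let F_q be a finite field with q elements. For every natural number k, the limit d_k = lim_{n→∞} e_{n,k}/q^n exists, where e_{n,k} is the number of monic polynomials of degree n over F_q whose excess equals k. (That is, the sequence n ↦ e_{n,k}/q^n converges in ℝ.) -/
open Polynomial Filter Topology

open scoped Classical in
/-- The excess of a polynomial over a field: total multiplicity of its irreducible
factorization minus the number of distinct irreducible factors. -/
noncomputable def excess {Fq : Type*} [Field Fq] (f : Polynomial Fq) : ℕ :=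
  (UniqueFactorizationMonoid.normalizedFactors f).card -
    (UniqueFactorizationMonoid.normalizedFactors f).toFinset.card

/-- `excessCount Fq n k` is the number of monic polynomials of degree `n` over `Fq`
with excess `k` (the quantity `e_{n,k}`). -/
noncomputable def excessCount (Fq : Type*) [Field Fq] (n k : ℕ) : ℕ :=
  {f : Polynomial Fq | f.Monic ∧ f.natDegree = n ∧ excess f = k}.ncard

/-- `nu Fq i` is the number of monic irreducible polynomials of degree `i` over `Fq`. -/
noncomputable def nu (Fq : Type*) [Field Fq] (i : ℕ) : ℕ :=
  {p : Polynomial Fq | p.Monic ∧ Irreducible p ∧ p.natDegree = i}.ncard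

/-- `sqfCount Fq n` is the number of squarefree monic polynomials of degree `n` over `Fq`
(the quantity `e_{n,0}`). -/
noncomputable def sqfCount (Fq : Type*) [Field Fq] (n : ℕ) : ℕ :=
  {f : Polynomial Fq | f.Monic ∧ f.natDegree = n ∧ Squarefree f}.ncard

open UniqueFactorizationMonoid in
open scoped Classical in
/-- The count of a normalized irreducible factor is governed by divisibility of powers. -/
lemma aux_le_count {F : Type*} [Field F] {p f : F[X]} (hp : Irreducible p)
    (hn : normalize p = p) (hf : f ≠ 0) (j : ℕ) :
    j ≤ (normalizedFactors f).count p ↔ p ^ j ∣ f := by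
  rw [pow_dvd_iff_le_emultiplicity, emultiplicity_eq_count_normalizedFactors hp hf, hn]
  exact_mod_cast Iff.rfl

lemma aux_card_sub {α : Type*} [DecidableEq α] (s : Multiset α) (u : Finset α)
    (hu : s.toFinset ⊆ u) :
    s.card - s.toFinset.card = ∑ a ∈ u, (s.count a - 1) := by
  have h1 : ∑ a ∈ u, (s.count a - 1) = ∑ a ∈ s.toFinset, (s.count a - 1) := by
    symm
    apply Finset.sum_subset hu
    intro x _ hx
    have : s.count x = 0 := by
      rw [Multiset.count_eq_zero]; simpa using hx
    simp [this]
  have h2 : ∑ a ∈ s.toFinset, (s.count a - 1) + s.toFinset.card = s.card := by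
    rw [← Multiset.toFinset_sum_count_eq s, Finset.card_eq_sum_ones, ← Finset.sum_add_distrib]
    apply Finset.sum_congr rfl
    intro x hx
    have : 1 ≤ s.count x := by
      rw [Multiset.one_le_count_iff_mem]; simpa using hx
    omega
  omega

open UniqueFactorizationMonoid in
open scoped Classical in
/-- If `f` has no square divisor `g²` with `deg g > m`, and `M` is divisible enough, then the
excess of `f` is the excess of `gcd M f`. -/
lemma aux_excess_gcd {F : Type*} [Field F] (f M : F[X]) (m : ℕ) (hf : f ≠ 0)
    (hM : ∀ g : F[X], g.Monic → g.natDegree ≤ m → g ^ (2 * m + 2) ∣ M)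
    (hbad : ¬ ∃ g : F[X], g.Monic ∧ m < g.natDegree ∧ g ^ 2 ∣ f) :
    excess (EuclideanDomain.gcd M f) = excess f := by
  set d := EuclideanDomain.gcd M f with hd
  have hdf : d ∣ f := EuclideanDomain.gcd_dvd_right M f
  have hd0 : d ≠ 0 := ne_zero_of_dvd_ne_zero hf hdf
  have hle := (dvd_iff_normalizedFactors_le_normalizedFactors hd0 hf).1 hdf
  unfold excess
  rw [aux_card_sub (normalizedFactors f) _ subset_rfl,
    aux_card_sub (normalizedFactors d) (normalizedFactors f).toFinset
      (Multiset.toFinset_subset.2 (Multiset.subset_of_le hle))]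
  apply Finset.sum_congr rfl
  intro p hp
  have hp' : p ∈ normalizedFactors f := Multiset.mem_toFinset.1 hp
  have hirr := irreducible_of_normalized_factor p hp'
  have hnorm := normalize_normalized_factor p hp'
  have hmon : p.Monic := by
    rw [← hnorm]; exact Polynomial.monic_normalize hirr.ne_zero
  have hcle : (normalizedFactors d).count p ≤ (normalizedFactors f).count p :=
    Multiset.count_le_of_le p hle
  by_cases hdeg : p.natDegree ≤ m
  · have hlt : (normalizedFactors f).count p < 2 * m + 2 := by
      by_contra hcon
      push Not at hcon
      rw [aux_le_count hirr hnorm hf] at hcon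
      apply hbad
      refine ⟨p ^ (m + 1), hmon.pow _, ?_, ?_⟩
      · rw [hmon.natDegree_pow]
        have := hirr.natDegree_pos
        nlinarith
      · rw [← pow_mul]
        convert hcon using 2
        ring
    have hge : (normalizedFactors f).count p ≤ (normalizedFactors d).count p := by
      rw [aux_le_count hirr hnorm hd0]
      apply EuclideanDomain.dvd_gcd
      · exact (pow_dvd_pow p hlt.le).trans (hM p hmon hdeg)
      · rw [← aux_le_count hirr hnorm hf]
    omega
  · have : (normalizedFactors f).count p < 2 := by
      by_contra hcon
      push Not at hcon
      rw [aux_le_count hirr hnorm hf] at hcon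
      exact hbad ⟨p, hmon, by omega, hcon⟩
    omega

/-- Monic polynomials of degree `n`. -/
def auxMon (F : Type*) [Field F] (n : ℕ) : Set F[X] := {f | f.Monic ∧ f.natDegree = n}

lemma aux_degreeLT_card (F : Type*) [Field F] [Fintype F] (n : ℕ) :
    {f : F[X] | f.degree < n}.Finite ∧ {f : F[X] | f.degree < n}.ncard = Fintype.card F ^ n := by
  have e := (degreeLTEquiv F n).toEquiv
  have hs : {f : F[X] | f.degree < n} = (degreeLT F n : Set F[X]) := by
    ext f; simp [mem_degreeLT]
  rw [hs]
  have hfin : Finite (degreeLT F n) := Finite.of_equiv _ e.symm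
  refine ⟨Set.toFinite (degreeLT F n : Set F[X]), ?_⟩
  rw [← Nat.card_coe_set_eq]
  have := Nat.card_congr e
  simpa using this

lemma aux_mon_card (F : Type*) [Field F] [Fintype F] (n : ℕ) :
    (auxMon F n).Finite ∧ (auxMon F n).ncard = Fintype.card F ^ n := by
  have hs : auxMon F n = (fun g : F[X] => X ^ n + g) '' {f : F[X] | f.degree < n} := by
    ext f
    constructor
    · rintro ⟨hm, hn⟩
      refine ⟨f - X ^ n, ?_, by simp⟩
      have hdeg : f.degree = n := by rw [degree_eq_natDegree hm.ne_zero, hn]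
      have := degree_sub_lt (p := f) (q := X ^ n) (by simp [hdeg]) hm.ne_zero (by simp [hm.leadingCoeff])
      simpa [hdeg] using this
    · rintro ⟨g, hg, rfl⟩
      have hg' : g.degree < n := hg
      refine ⟨monic_X_pow_add hg', ?_⟩
      apply natDegree_eq_of_degree_eq_some
      rw [degree_add_eq_left_of_degree_lt (by simpa using hg')]
      simp
  obtain ⟨h1, h2⟩ := aux_degreeLT_card F n
  rw [hs]
  refine ⟨h1.image _, ?_⟩
  rw [Set.ncard_image_of_injective _ (fun a b h => by simpa using h), h2]

/-- Counting monic polynomials with prescribed residues. -/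
lemma aux_periodic (F : Type*) [Field F] [Fintype F] (M : F[X]) (hM : M.Monic)
    (P : F[X] → Prop) (n : ℕ) (hn : M.natDegree ≤ n) :
    {f | f ∈ auxMon F n ∧ P (f % M)}.ncard =
      Fintype.card F ^ (n - M.natDegree) * {r : F[X] | r.degree < M.degree ∧ P r}.ncard := by
  have hs : {f | f ∈ auxMon F n ∧ P (f % M)} = (fun x : F[X] × F[X] => x.2 + M * x.1) ''
      (auxMon F (n - M.natDegree) ×ˢ {r : F[X] | r.degree < M.degree ∧ P r}) := by
    ext f
    constructor
    · rintro ⟨⟨hm, hd⟩, hP⟩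
      refine ⟨(f /ₘ M, f %ₘ M), ⟨⟨?_, ?_⟩, ?_, ?_⟩, ?_⟩
      · rw [Monic, leadingCoeff_divByMonic_of_monic hM]
        · exact hm
        · rw [degree_eq_natDegree hM.ne_zero, degree_eq_natDegree hm.ne_zero, hd]
          exact_mod_cast hn
      · rw [natDegree_divByMonic _ hM, hd]
      · exact degree_modByMonic_lt _ hM
      · rwa [modByMonic_eq_mod _ hM]
      · exact modByMonic_add_div _ M
    · rintro ⟨⟨h, r⟩, ⟨⟨hm, hd⟩, hr, hP⟩, rfl⟩
      simp only at hm hd hr hP ⊢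
      have hMh : (M * h).Monic := hM.mul hm
      have hnd : (M * h).natDegree = n := by
        rw [hM.natDegree_mul hm, hd]; omega
      have hlt : r.degree < (M * h).degree := by
        refine hr.trans_le ?_
        exact degree_le_mul_left M hm.ne_zero
      refine ⟨⟨?_, ?_⟩, ?_⟩
      · exact hMh.add_of_right hlt
      · rw [natDegree_add_eq_right_of_degree_lt hlt, hnd]
      · rw [← modByMonic_eq_mod _ hM, (div_modByMonic_unique h r hM ⟨rfl, hr⟩).2]
        exact hP
  rw [hs, Set.ncard_image_of_injOn, Set.ncard_prod, (aux_mon_card F _).2]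
  rintro ⟨h, r⟩ ⟨_, hr, _⟩ ⟨h', r'⟩ ⟨_, hr', _⟩ he
  have a := div_modByMonic_unique h r hM ⟨rfl, hr⟩
  have b := div_modByMonic_unique h' r' hM ⟨rfl, hr'⟩
  simp only at he a b
  rw [he] at a
  rw [Prod.mk.injEq]
  exact ⟨a.1.symm.trans b.1, a.2.symm.trans b.2⟩

lemma aux_tail (q : ℝ) (hq : 2 ≤ q) (m K : ℕ) (h : m ≤ K) :
    ∑ d ∈ Finset.Ioc m K, (q ^ d)⁻¹ ≤ (q ^ m)⁻¹ - (q ^ K)⁻¹ := by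
  induction K, h using Nat.le_induction with
  | base => simp
  | succ K hK ih =>
    rw [Finset.sum_Ioc_succ_top hK]
    have : (q ^ K)⁻¹ = q * (q ^ (K + 1))⁻¹ := by
      have : q ≠ 0 := by linarith
      rw [pow_succ]; field_simp
    have h0 : 0 ≤ (q ^ (K + 1))⁻¹ := by positivity
    nlinarith

/-- The polynomials with a large square divisor. -/
lemma aux_bad (F : Type*) [Field F] [Fintype F] (m n : ℕ) :
    (({f | f ∈ auxMon F n ∧ ∃ g : F[X], g.Monic ∧ m < g.natDegree ∧ g ^ 2 ∣ f}.ncard : ℕ) : ℝ)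
      / (Fintype.card F : ℝ) ^ n ≤ ((Fintype.card F : ℝ) ^ m)⁻¹ := by
  set q := Fintype.card F with hqdef
  have hq : (2 : ℝ) ≤ q := by exact_mod_cast Fintype.one_lt_card
  have hq0 : (0 : ℝ) < q := by linarith
  let B : ℕ → Set F[X] := fun d => if 2 * d ≤ n then
    (fun x : F[X] × F[X] => x.1 ^ 2 * x.2) '' (auxMon F d ×ˢ auxMon F (n - 2 * d)) else ∅
  have hBfin : ∀ d, (B d).Finite := by
    intro d
    simp only [B]
    split_ifs
    · exact (((aux_mon_card F d).1.prod (aux_mon_card F _).1)).image _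
    · exact Set.finite_empty
  have hBcard : ∀ d, ((B d).ncard : ℝ) ≤ (q : ℝ) ^ n * ((q : ℝ) ^ d)⁻¹ := by
    intro d
    simp only [B]
    split_ifs with h
    · have h1 := Set.ncard_image_le (f := fun x : F[X] × F[X] => x.1 ^ 2 * x.2)
        ((aux_mon_card F d).1.prod (aux_mon_card F (n - 2 * d)).1)
      rw [Set.ncard_prod, (aux_mon_card F _).2, (aux_mon_card F _).2] at h1
      have h2 : (q : ℝ) ^ n * ((q : ℝ) ^ d)⁻¹ = ((q ^ d * q ^ (n - 2 * d) : ℕ) : ℝ) := by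
        push_cast
        rw [← pow_add, mul_inv_eq_iff_eq_mul₀ (by positivity), ← pow_add]
        congr 1; omega
      rw [h2]
      exact_mod_cast h1
    · simp; positivity
  have hsub : {f | f ∈ auxMon F n ∧ ∃ g : F[X], g.Monic ∧ m < g.natDegree ∧ g ^ 2 ∣ f} ⊆
      ⋃ d ∈ Finset.Ioc m (m + n), B d := by
    rintro f ⟨⟨hm, hd⟩, g, hg, hgm, h, rfl⟩
    have hh : h.Monic := (hg.pow 2).of_mul_monic_left hm
    rw [(hg.pow 2).natDegree_mul hh, hg.natDegree_pow] at hd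
    simp only [Set.mem_iUnion]
    refine ⟨g.natDegree, by rw [Finset.mem_Ioc]; omega, ?_⟩
    simp only [B]
    rw [if_pos (by omega)]
    exact ⟨(g, h), ⟨⟨hg, rfl⟩, hh, by simp only; omega⟩, rfl⟩
  have h1 : {f | f ∈ auxMon F n ∧ ∃ g : F[X], g.Monic ∧ m < g.natDegree ∧ g ^ 2 ∣ f}.ncard ≤
      ∑ d ∈ Finset.Ioc m (m + n), (B d).ncard :=
    (Set.ncard_le_ncard hsub ((Finset.finite_toSet _).biUnion fun d _ => hBfin d)).trans
      (Finset.set_ncard_biUnion_le _ _)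
  rw [div_le_iff₀ (by positivity)]
  calc _ ≤ ((∑ d ∈ Finset.Ioc m (m + n), (B d).ncard : ℕ) : ℝ) := by exact_mod_cast h1
    _ ≤ ∑ d ∈ Finset.Ioc m (m + n), (q : ℝ) ^ n * ((q : ℝ) ^ d)⁻¹ := by
        push_cast
        exact Finset.sum_le_sum fun d _ => hBcard d
    _ = (q : ℝ) ^ n * ∑ d ∈ Finset.Ioc m (m + n), ((q : ℝ) ^ d)⁻¹ := by rw [Finset.mul_sum]
    _ ≤ (q : ℝ) ^ n * ((q : ℝ) ^ m)⁻¹ := by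
        have := aux_tail q hq m (m + n) (by omega)
        have h0 : 0 ≤ ((q : ℝ) ^ (m + n))⁻¹ := by positivity
        gcongr
        linarith
    _ = _ := mul_comm _ _

lemma aux_exists_modulus (F : Type*) [Field F] [Fintype F] (m : ℕ) :
    ∃ M : F[X], M.Monic ∧
      ∀ g : F[X], g.Monic → g.natDegree ≤ m → g ^ (2 * m + 2) ∣ M := by
  have hfin : (⋃ d ∈ Finset.range (m + 1), auxMon F d).Finite :=
    (Finset.finite_toSet _).biUnion fun d _ => (aux_mon_card F d).1
  refine ⟨∏ g ∈ hfin.toFinset, g ^ (2 * m + 2), ?_, ?_⟩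
  · apply monic_prod_of_monic
    intro g hg
    simp only [Set.Finite.mem_toFinset, Set.mem_iUnion] at hg
    obtain ⟨d, _, hg⟩ := hg
    exact hg.1.pow _
  · intro g hg hd
    apply Finset.dvd_prod_of_mem (fun g : F[X] => g ^ (2 * m + 2))
    simp only [Set.Finite.mem_toFinset, Set.mem_iUnion]
    exact ⟨g.natDegree, by rw [Finset.mem_range]; omega, hg, rfl⟩

open scoped Classical in
/-- Approximation of the excess densities by an eventually constant sequence. -/
lemma aux_approx (F : Type*) [Field F] [Fintype F] (k m : ℕ) :
    ∃ (c : ℝ) (N : ℕ), ∀ n ≥ N,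
      |(excessCount F n k : ℝ) / (Fintype.card F : ℝ) ^ n - c| ≤ ((Fintype.card F : ℝ) ^ m)⁻¹ := by
  obtain ⟨M, hMm, hM⟩ := aux_exists_modulus F m
  set q := Fintype.card F with hqdef
  have hq : (2 : ℝ) ≤ q := by exact_mod_cast Fintype.one_lt_card
  have hq0 : (0 : ℝ) < q := by linarith
  let P : F[X] → Prop := fun r => excess (EuclideanDomain.gcd r M) = k
  refine ⟨({r : F[X] | r.degree < M.degree ∧ P r}.ncard : ℝ) / (q : ℝ) ^ M.natDegree,
    M.natDegree, fun n hn => ?_⟩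
  have hper := aux_periodic F M hMm P n hn
  have hc : ({r : F[X] | r.degree < M.degree ∧ P r}.ncard : ℝ) / (q : ℝ) ^ M.natDegree =
      ({f | f ∈ auxMon F n ∧ P (f % M)}.ncard : ℝ) / (q : ℝ) ^ n := by
    rw [hper]
    push_cast
    have : (q : ℝ) ^ n = (q : ℝ) ^ (n - M.natDegree) * (q : ℝ) ^ M.natDegree := by
      rw [← pow_add]; congr 1; omega
    rw [this]
    field_simp
    rfl
  rw [hc]
  set Bad := {f | f ∈ auxMon F n ∧ ∃ g : F[X], g.Monic ∧ m < g.natDegree ∧ g ^ 2 ∣ f} with hBad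
  set A := {f : F[X] | f.Monic ∧ f.natDegree = n ∧ excess f = k} with hA
  set A' := {f | f ∈ auxMon F n ∧ P (f % M)} with hA'
  have hfin := (aux_mon_card F n).1
  have hBfin : Bad.Finite := hfin.subset fun f hf => hf.1
  have hAfin : A.Finite := hfin.subset fun f hf => ⟨hf.1, hf.2.1⟩
  have hA'fin : A'.Finite := hfin.subset fun f hf => hf.1
  have key : ∀ f ∈ auxMon F n, f ∉ Bad → (excess f = k ↔ P (f % M)) := by
    intro f hf hb
    have := aux_excess_gcd f M m hf.1.ne_zero hM (fun h => hb ⟨hf, h⟩)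
    simp only [P]
    rw [← EuclideanDomain.gcd_val, this]
  have s1 : A ⊆ A' ∪ Bad := by
    intro f hf
    by_cases hb : f ∈ Bad
    · exact Or.inr hb
    · exact Or.inl ⟨⟨hf.1, hf.2.1⟩, (key f ⟨hf.1, hf.2.1⟩ hb).1 hf.2.2⟩
  have s2 : A' ⊆ A ∪ Bad := by
    intro f hf
    by_cases hb : f ∈ Bad
    · exact Or.inr hb
    · exact Or.inl ⟨hf.1.1, hf.1.2, (key f hf.1 hb).2 hf.2⟩
  have c1 : (A.ncard : ℝ) ≤ A'.ncard + Bad.ncard := by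
    exact_mod_cast (Set.ncard_le_ncard s1 (hA'fin.union hBfin)).trans (Set.ncard_union_le _ _)
  have c2 : (A'.ncard : ℝ) ≤ A.ncard + Bad.ncard := by
    exact_mod_cast (Set.ncard_le_ncard s2 (hAfin.union hBfin)).trans (Set.ncard_union_le _ _)
  have hbad := aux_bad F m n
  have hAe : excessCount F n k = A.ncard := rfl
  rw [hAe, ← sub_div, abs_div, abs_of_pos (show (0 : ℝ) < (q : ℝ) ^ n by positivity)]
  refine le_trans ?_ hbad
  gcongr
  rw [abs_le]
  constructor <;> linarith

/-- for each `k`, the limit `d_k = lim_{n→∞} e_{n,k}/q^n` exists. -/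
theorem renyi_density_exists (q : ℕ) (hq : 2 ≤ q) (Fq : Type*) [Field Fq] [Fintype Fq]
    (hcard : Fintype.card Fq = q) (k : ℕ) :
    ∃ L : ℝ, Tendsto (fun n : ℕ => (excessCount Fq n k : ℝ) / (q : ℝ) ^ n) atTop (𝓝 L) := by
  apply cauchySeq_tendsto_of_complete
  rw [Metric.cauchySeq_iff]
  intro ε hε
  have hq' : (2 : ℝ) ≤ q := by exact_mod_cast hq
  obtain ⟨m, hm⟩ := exists_pow_lt_of_lt_one (show 0 < ε / 2 by linarith)
    (show ((q : ℝ)⁻¹) < 1 from inv_lt_one_of_one_lt₀ (by linarith))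
  rw [inv_pow] at hm
  obtain ⟨c, N, hN⟩ := aux_approx Fq k m
  rw [hcard] at hN
  refine ⟨N, fun a ha b hb => ?_⟩
  have h1 := hN a ha
  have h2 := hN b hb
  rw [Real.dist_eq, abs_lt]
  rw [abs_le] at h1 h2
  constructor <;> linarith
end

section
/- Let q ≥ 2, let F_q be a finite field with q elements, and for each k let d_k = lim_{n→∞} e_{n,k}/q^n (which exists). Then for every complex number z with |z| < √q, the series ∑_{k≥0} d_k z^k converges and equals the absolutely convergent infinite product ∏_π (1 − 1/Nπ)(1 + 1/(Nπ − z)), taken over all monic irreducible polynomials π in F_q[x], where Nπ = q^{deg π}. -/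
open Polynomial Filter Topology

lemma sum_finsupp_prod {I R : Type*} [CommRing R] (a : I → ℕ → R) (h0 : ∀ i, a i 0 = 1)
    (S : Finset I) (t : I → Finset ℕ) :
    ∑ e ∈ S.finsupp t, e.prod a = ∏ i ∈ S, ∑ j ∈ t i, a i j := by
  classical
  rw [Finset.prod_sum, Finset.finsupp, Finset.sum_map]
  refine Finset.sum_congr rfl fun p hp => ?_
  change (Finsupp.indicator S p).prod a = _
  rw [Finsupp.prod_of_support_subset (s := S) _ (Finsupp.support_indicator_subset _ _) _ (fun i _ => h0 i),
    ← Finset.prod_attach]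
  refine Finset.prod_congr rfl fun i _ => ?_
  simp

lemma subset_box {I : Type*} (T : Finset (I →₀ ℕ)) :
    ∃ (S : Finset I) (N : ℕ), ∀ S' N', S ⊆ S' → N ≤ N' → T ⊆ S'.finsupp (fun _ => Finset.range N') := by
  classical
  refine ⟨T.biUnion fun e => e.support, (T.sup fun e => e.support.sup e) + 1, ?_⟩
  intro S' N' hS hN e he
  rw [Finset.mem_finsupp_iff]
  have h1 : e.support ⊆ S' := (Finset.subset_biUnion_of_mem (fun e : I →₀ ℕ => e.support) he).trans hS
  refine ⟨h1, fun i _ => ?_⟩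
  rw [Finset.mem_range]
  by_cases hi : i ∈ e.support
  · have h2 : e i ≤ e.support.sup e := Finset.le_sup hi
    have h3 : (e.support.sup e) ≤ (T.sup fun e => e.support.sup e) :=
      Finset.le_sup (f := fun e : I →₀ ℕ => e.support.sup e) he
    omega
  · have : e i = 0 := by simpa using hi
    omega

lemma euler_summable {I : Type*} (a : I → ℕ → ℂ) (h0 : ∀ i, a i 0 = 1) (b : I → ℝ)
    (hb : Summable b) (ha : ∀ i, Summable fun j => ‖a i j‖) (hab : ∀ i, ∑' j, ‖a i j‖ ≤ 1 + b i) :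
    Summable fun e : I →₀ ℕ => ‖e.prod a‖ := by
  have hb0 : ∀ i, 0 ≤ b i := fun i => by
    have : ‖a i 0‖ ≤ ∑' j, ‖a i j‖ := (ha i).le_tsum 0 (fun j _ => norm_nonneg _)
    rw [h0, norm_one] at this
    linarith [hab i]
  refine summable_of_sum_le (c := Real.exp (∑' i, b i)) (fun _ => norm_nonneg _) fun T => ?_
  obtain ⟨S, N, h⟩ := subset_box T
  have hn : ∀ e : I →₀ ℕ, ‖e.prod a‖ = e.prod fun i j => ‖a i j‖ := fun e => by
    simp [Finsupp.prod, norm_prod]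
  calc ∑ e ∈ T, ‖e.prod a‖ ≤ ∑ e ∈ S.finsupp (fun _ => Finset.range N), ‖e.prod a‖ :=
        Finset.sum_le_sum_of_subset_of_nonneg (h S N subset_rfl le_rfl) (fun _ _ _ => norm_nonneg _)
    _ = ∏ i ∈ S, ∑ j ∈ Finset.range N, ‖a i j‖ := by
        simp_rw [hn]
        exact sum_finsupp_prod _ (fun i => by simp [h0]) _ _
    _ ≤ ∏ i ∈ S, (1 + b i) := by
        refine Finset.prod_le_prod (fun i _ => by positivity) fun i _ => ?_
        exact ((ha i).sum_le_tsum _ (fun _ _ => norm_nonneg _)).trans (hab i)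
    _ ≤ Real.exp (∑ i ∈ S, b i) := by
        rw [Real.exp_sum]
        refine Finset.prod_le_prod (fun i _ => by linarith [hb0 i]) fun i _ => ?_
        linarith [Real.add_one_le_exp (b i)]
    _ ≤ _ := Real.exp_le_exp.2 (hb.sum_le_tsum _ (fun i _ => hb0 i))

lemma euler_hasProd {I : Type*} (a : I → ℕ → ℂ) (h0 : ∀ i, a i 0 = 1) (A : I → ℂ)
    (hA : ∀ i, HasSum (a i) (A i)) (L : ℂ) (hL : HasSum (fun e : I →₀ ℕ => e.prod a) L) :
    HasProd A L := by
  rw [HasProd]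
  simp only [SummationFilter.unconditional_filter]
  rw [Metric.tendsto_nhds]
  intro ε hε
  simp only [HasSum, SummationFilter.unconditional_filter] at hL
  rw [Metric.tendsto_nhds] at hL
  obtain ⟨T, hT⟩ := eventually_atTop.1 (hL (ε / 2) (by positivity))
  obtain ⟨S, N, h⟩ := subset_box T
  refine eventually_atTop.2 ⟨S, fun S' hS => ?_⟩
  have hlim : Tendsto (fun N => ∑ e ∈ S'.finsupp (fun _ => Finset.range N), e.prod a) atTop
      (𝓝 (∏ i ∈ S', A i)) := by
    simp_rw [sum_finsupp_prod a h0]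
    exact tendsto_finsetProd _ fun i _ => (hA i).tendsto_sum_nat
  have : dist (∏ i ∈ S', A i) L ≤ ε/2 := by
    refine le_of_tendsto (hlim.dist tendsto_const_nhds) ?_
    filter_upwards [eventually_ge_atTop N] with N' hN
    exact (hT _ (h S' N' hS hN)).le
  linarith

/-- Local convolution coefficients. -/
noncomputable def hc (z : ℂ) : ℕ → ℂ
  | 0 => 1
  | 1 => 0
  | j + 2 => z ^ (j + 1) - z ^ j

lemma sum_hc (z : ℂ) (m : ℕ) : ∑ j ∈ Finset.range (m + 1), hc z j = z ^ (m - 1) := by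
  induction m with
  | zero => simp [hc]
  | succ m ih =>
    rw [Finset.sum_range_succ, ih]
    rcases m with _ | m
    · simp [hc]
    · simp [hc]

lemma hasSum_hc (z x : ℂ) (h : ‖z * x‖ < 1) :
    HasSum (fun j => hc z j * x ^ j) (1 + (z - 1) * x ^ 2 * (1 - z * x)⁻¹) := by
  rw [← hasSum_nat_add_iff' 2]
  simp only [Finset.sum_range_succ, Finset.sum_range_zero, hc]
  have e1 : (fun j : ℕ => (z ^ (j + 1) - z ^ j) * x ^ (j + 2)) =
      fun j => (z - 1) * x ^ 2 * (z * x) ^ j := by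
    ext j; ring
  have e2 : 1 + (z - 1) * x ^ 2 * (1 - z * x)⁻¹ - (0 + 1 * x ^ 0 + 0 * x ^ 1) =
      (z - 1) * x ^ 2 * (1 - z * x)⁻¹ := by
    rw [pow_zero]; ring
  rw [e1, e2]
  exact (hasSum_geometric_of_norm_lt_one h).mul_left ((z - 1) * x ^ 2)

lemma hasSum_norm_hc_aux (r x : ℝ) (hr : 0 ≤ r) (hx : 0 ≤ x) (h : r * x < 1) :
    HasSum (fun j => ((r + 1) * x ^ 2) * (r * x) ^ j) ((r + 1) * x ^ 2 * (1 - r * x)⁻¹) :=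
  (hasSum_geometric_of_lt_one (by positivity) h).mul_left _

lemma norm_hc_bound (z : ℂ) (x : ℝ) (hx : 0 ≤ x) (h : ‖z‖ * x < 1) :
    Summable (fun j => ‖hc z j * (x : ℂ) ^ j‖) ∧
    ∑' j, ‖hc z j * (x : ℂ) ^ j‖ ≤ 1 + (‖z‖ + 1) * x ^ 2 * (1 - ‖z‖ * x)⁻¹ := by
  have hs := hasSum_norm_hc_aux ‖z‖ x (norm_nonneg _) hx h
  have hle : ∀ j, ‖hc z (j + 2) * (x : ℂ) ^ (j + 2)‖ ≤ ((‖z‖ + 1) * x ^ 2) * (‖z‖ * x) ^ j := by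
    intro j
    have : hc z (j + 2) * (x : ℂ) ^ (j + 2) = (z - 1) * (x : ℂ) ^ 2 * (z * x) ^ j := by
      simp only [hc]; ring
    rw [this]
    simp only [norm_mul, norm_pow, Complex.norm_real, Real.norm_of_nonneg hx]
    gcongr
    simpa using norm_sub_le z 1
  have h1 : Summable (fun j => ‖hc z (j + 2) * (x : ℂ) ^ (j + 2)‖) :=
    hs.summable.of_nonneg_of_le (fun _ => norm_nonneg _) hle
  have h2 : Summable (fun j => ‖hc z j * (x : ℂ) ^ j‖) :=
    (summable_nat_add_iff (f := fun j => ‖hc z j * (x : ℂ) ^ j‖) 2).1 h1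
  refine ⟨h2, ?_⟩
  rw [← h2.sum_add_tsum_nat_add 2]
  have := h1.tsum_le_tsum hle hs.summable
  rw [hs.tsum_eq] at this
  simp only [Finset.sum_range_succ, Finset.sum_range_zero]
  simp only [hc] at this ⊢
  simpa using this

lemma pow_exc_eq {I : Type*} [DecidableEq I] (z : ℂ) (s : I →₀ ℕ) :
    ∑ g ∈ Finset.Iic s, g.prod (fun _ j => hc z j) = z ^ (s.sum fun _ j => j - 1) := by
  classical
  have : Finset.Iic s = s.support.finsupp (fun i => Finset.range (s i + 1)) := by
    ext g
    rw [Finset.mem_finsupp_iff, Finset.mem_Iic]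
    constructor
    · intro h
      refine ⟨Finsupp.support_mono h, fun i _ => ?_⟩
      rw [Finset.mem_range]
      have := h i
      omega
    · rintro ⟨h1, h2⟩ i
      by_cases hi : i ∈ s.support
      · have := Finset.mem_range.1 (h2 i hi); omega
      · have : g i = 0 := by
          by_contra hg
          exact hi (h1 (by simpa using hg))
        omega
  rw [this, sum_finsupp_prod _ (fun _ => rfl)]
  simp_rw [sum_hc]
  rw [Finset.prod_pow_eq_pow_sum]; rfl

/-- Degree of a finitely supported exponent vector. -/
noncomputable def wdeg {I : Type*} (w : I → ℕ) (e : I →₀ ℕ) : ℕ := e.sum fun i j => j * w i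

lemma wdeg_add {I : Type*} (w : I → ℕ) (e f : I →₀ ℕ) : wdeg w (e + f) = wdeg w e + wdeg w f := by
  classical
  exact Finsupp.sum_add_index' (by simp) (by intros; ring)

/-- The averaging identity. -/
lemma avg_identity {I : Type*} [DecidableEq I] (w : I → ℕ) (q : ℕ) (hq : q ≠ 0) (D : ℕ → Finset (I →₀ ℕ))
    (hD : ∀ n e, e ∈ D n ↔ wdeg w e = n) (hDc : ∀ n, (D n).card = q ^ n) (z : ℂ) (n : ℕ) :
    (∑ s ∈ D n, z ^ (s.sum fun _ j => j - 1)) / (q : ℂ) ^ n =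
      ∑ g ∈ (Finset.range (n + 1)).biUnion D,
        g.prod (fun i j => hc z j * (((q : ℝ) ^ w i)⁻¹ : ℝ) ^ j) := by
  classical
  have hq' : (q : ℂ) ≠ 0 := by exact_mod_cast hq
  have hp : ∀ g : I →₀ ℕ, g.prod (fun i j => hc z j * ((((q : ℝ) ^ w i)⁻¹ : ℝ) : ℂ) ^ j) =
      g.prod (fun _ j => hc z j) / (q : ℂ) ^ wdeg w g := by
    intro g
    rw [Finsupp.prod_mul, div_eq_mul_inv, wdeg]
    congr 1
    simp only [Finsupp.prod, Finsupp.sum]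
    rw [← Finset.prod_pow_eq_pow_sum, ← Finset.prod_inv_distrib]
    refine Finset.prod_congr rfl fun i _ => ?_
    push_cast
    rw [inv_pow, ← pow_mul, mul_comm]
  simp_rw [hp, ← pow_exc_eq]
  rw [Finset.sum_comm' (t' := (Finset.range (n + 1)).biUnion D) (s' := fun g => (D n).filter (g ≤ ·)),
    Finset.sum_div]
  · refine Finset.sum_congr rfl fun g hg => ?_
    have hg' : wdeg w g ≤ n := by
      simp only [Finset.mem_biUnion, Finset.mem_range, hD] at hg
      obtain ⟨m, hm, rfl⟩ := hg
      omega
    have hcard : ((D n).filter (g ≤ ·)).card = q ^ (n - wdeg w g) := by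
      rw [← hDc]
      refine Finset.card_bij' (fun s _ => s - g) (fun s _ => s + g) ?_ ?_ ?_ ?_
      · intro s hs
        simp only [Finset.mem_filter, hD] at hs ⊢
        have := wdeg_add w (s - g) g
        rw [tsub_add_cancel_of_le hs.2] at this
        omega
      · intro s hs
        simp only [Finset.mem_filter, hD] at hs ⊢
        rw [wdeg_add]
        exact ⟨by omega, le_add_self⟩
      · intro s hs
        simp only [Finset.mem_filter] at hs
        exact tsub_add_cancel_of_le hs.2
      · intro s hs
        exact add_tsub_cancel_right _ _
    rw [Finset.sum_const, hcard, nsmul_eq_mul]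
    push_cast
    rw [div_eq_div_iff (by positivity) (by positivity)]
    have : (q : ℂ) ^ n = q ^ (n - wdeg w g) * q ^ wdeg w g := by
      rw [← pow_add]; congr 1; omega
    rw [this]; ring
  · intro s g
    simp only [Finset.mem_Iic, Finset.mem_filter, Finset.mem_biUnion, Finset.mem_range, hD]
    constructor
    · rintro ⟨h1, h2⟩
      refine ⟨⟨h1, h2⟩, _, ?_, rfl⟩
      have := wdeg_add w (s - g) g
      rw [tsub_add_cancel_of_le h2] at this
      omega
    · rintro ⟨h, _⟩
      exact h

lemma summable_norm_sq {I : Type*} (w : I → ℕ) (q : ℕ) (hq : 2 ≤ q) (D : ℕ → Finset (I →₀ ℕ))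
    (hD : ∀ n e, e ∈ D n ↔ wdeg w e = n) (hDc : ∀ n, (D n).card = q ^ n) :
    Summable fun i => (((q : ℝ) ^ w i)⁻¹) ^ 2 := by
  classical
  have hq1 : (1 : ℝ) < q := by exact_mod_cast hq
  have hq0 : (0 : ℝ) < q := by linarith
  have hgeo : Summable fun m : ℕ => ((q : ℝ)⁻¹) ^ m :=
    summable_geometric_of_lt_one (by positivity) (inv_lt_one_of_one_lt₀ hq1)
  refine summable_of_sum_le (c := ∑' m : ℕ, ((q : ℝ)⁻¹) ^ m) (fun _ => by positivity) fun T => ?_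
  rw [← Finset.sum_fiberwise_of_maps_to (t := T.image w) (g := w)
    (fun i hi => Finset.mem_image_of_mem w hi)]
  refine le_trans (Finset.sum_le_sum fun m _ => ?_)
    (hgeo.sum_le_tsum (T.image w) (fun _ _ => by positivity))
  have hc : (T.filter fun i => w i = m).card ≤ q ^ m := by
    rw [← hDc]
    refine Finset.card_le_card_of_injOn (fun i => Finsupp.single i 1) ?_ ?_
    · intro i hi
      have hi' : w i = m := by simpa using (Finset.mem_filter.1 hi).2
      simp [hD, wdeg, hi']
    · intro i _ j _ h
      exact Finsupp.single_left_injective one_ne_zero h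
  calc ∑ i ∈ T with w i = m, (((q : ℝ) ^ w i)⁻¹) ^ 2 = ∑ i ∈ T with w i = m, (((q : ℝ) ^ m)⁻¹) ^ 2 :=
        Finset.sum_congr rfl fun i hi => by rw [(Finset.mem_filter.1 hi).2]
    _ = ((T.filter fun i => w i = m).card : ℝ) * (((q : ℝ) ^ m)⁻¹) ^ 2 := by simp
    _ ≤ (q : ℝ) ^ m * (((q : ℝ) ^ m)⁻¹) ^ 2 := by
        gcongr
        exact_mod_cast hc
    _ = ((q : ℝ)⁻¹) ^ m := by
        have : (q : ℝ) ^ m ≠ 0 := by positivity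
        rw [inv_pow (q : ℝ) m]
        field_simp

lemma abstract_main {I : Type*} (w : I → ℕ) (hw : ∀ i, 1 ≤ w i) (q : ℕ) (hq : 2 ≤ q)
    (D : ℕ → Finset (I →₀ ℕ))
    (hD : ∀ n e, e ∈ D n ↔ wdeg w e = n) (hDc : ∀ n, (D n).card = q ^ n) (z : ℂ) (hz : ‖z‖ < q) :
    (Summable fun i => ‖(1 - 1 / (q : ℂ) ^ w i) * (1 + 1 / ((q : ℂ) ^ w i - z)) - 1‖) ∧
    ∃ L, HasProd (fun i => (1 - 1 / (q : ℂ) ^ w i) * (1 + 1 / ((q : ℂ) ^ w i - z))) L ∧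
      Tendsto (fun n => (∑ s ∈ D n, z ^ (s.sum fun _ j => j - 1)) / (q : ℂ) ^ n) atTop (𝓝 L) := by
  classical
  have hq1 : (1 : ℝ) < q := by exact_mod_cast hq
  have hq0 : (0 : ℝ) < q := by linarith
  have hqw : ∀ i, (q : ℝ) ≤ (q : ℝ) ^ w i := fun i => le_self_pow₀ hq1.le (by have := hw i; omega)
  set x : I → ℝ := fun i => ((q : ℝ) ^ w i)⁻¹ with hx
  have hx0 : ∀ i, 0 < x i := fun i => by simp only [hx]; positivity
  have hxq : ∀ i, x i ≤ (q : ℝ)⁻¹ := fun i => inv_anti₀ hq0 (hqw i)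
  have hzq : ‖z‖ * (q : ℝ)⁻¹ < 1 := by
    rw [← div_eq_mul_inv, div_lt_one hq0]; exact hz
  have hzx' : ∀ i, ‖z‖ * x i ≤ ‖z‖ * (q : ℝ)⁻¹ := fun i =>
    mul_le_mul_of_nonneg_left (hxq i) (norm_nonneg _)
  have hzx : ∀ i, ‖z‖ * x i < 1 := fun i => (hzx' i).trans_lt hzq
  have hbs : Summable fun i => (‖z‖ + 1) * (1 - ‖z‖ * (q : ℝ)⁻¹)⁻¹ * x i ^ 2 :=
    (summable_norm_sq w q hq D hD hDc).mul_left _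
  have hbb : ∀ i, (‖z‖ + 1) * x i ^ 2 * (1 - ‖z‖ * x i)⁻¹ ≤
      (‖z‖ + 1) * (1 - ‖z‖ * (q : ℝ)⁻¹)⁻¹ * x i ^ 2 := by
    intro i
    have : (1 - ‖z‖ * x i)⁻¹ ≤ (1 - ‖z‖ * (q : ℝ)⁻¹)⁻¹ :=
      inv_anti₀ (by linarith) (by linarith [hzx' i])
    calc _ ≤ (‖z‖ + 1) * x i ^ 2 * (1 - ‖z‖ * (q : ℝ)⁻¹)⁻¹ := by gcongr
      _ = _ := by ring
  have hloc : ∀ i, (1 - 1 / (q : ℂ) ^ w i) * (1 + 1 / ((q : ℂ) ^ w i - z)) =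
      1 + (z - 1) * (x i : ℂ) ^ 2 * (1 - z * x i)⁻¹ := by
    intro i
    have hN : (q : ℂ) ^ w i ≠ 0 := pow_ne_zero _ (by exact_mod_cast hq0.ne')
    have hNz : (q : ℂ) ^ w i - z ≠ 0 := by
      intro h
      have h2 : z = (q : ℂ) ^ w i := (sub_eq_zero.1 h).symm
      have h3 : ‖z‖ = (q : ℝ) ^ w i := by rw [h2]; simp
      linarith [hqw i]
    have hxi : (x i : ℂ) = ((q : ℂ) ^ w i)⁻¹ := by simp [hx]
    rw [hxi]
    generalize (q : ℂ) ^ w i = N at *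
    have : (1 - z * N⁻¹) = (N - z) / N := by field_simp
    rw [this]
    field_simp
    ring
  set a : I → ℕ → ℂ := fun i j => hc z j * (x i : ℂ) ^ j with ha
  have ha0 : ∀ i, a i 0 = 1 := fun i => by simp [ha, hc]
  have hsum : Summable fun e : I →₀ ℕ => ‖e.prod a‖ :=
    euler_summable a ha0 _ hbs (fun i => (norm_hc_bound z (x i) (hx0 i).le (hzx i)).1)
      (fun i => (norm_hc_bound z (x i) (hx0 i).le (hzx i)).2.trans (by linarith [hbb i]))
  have hsum' : Summable fun e : I →₀ ℕ => e.prod a := hsum.of_norm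
  constructor
  · refine hbs.of_nonneg_of_le (fun _ => norm_nonneg _) fun i => le_trans ?_ (hbb i)
    rw [hloc]
    simp only [add_sub_cancel_left, norm_mul, norm_pow, norm_inv, Complex.norm_real,
      Real.norm_of_nonneg (hx0 i).le]
    have h1 : ‖z - 1‖ ≤ ‖z‖ + 1 := by simpa using norm_sub_le z 1
    have h2 : 1 - ‖z‖ * x i ≤ ‖1 - z * x i‖ := by
      have := norm_sub_norm_le 1 (z * (x i : ℂ))
      simpa [abs_of_pos (hx0 i)] using this
    have h3 : ‖1 - z * x i‖⁻¹ ≤ (1 - ‖z‖ * x i)⁻¹ := inv_anti₀ (by linarith [hzx i]) h2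
    gcongr
  · refine ⟨∑' e : I →₀ ℕ, e.prod a, ?_, ?_⟩
    · refine euler_hasProd a ha0 _ (fun i => ?_) _ hsum'.hasSum
      rw [hloc]
      refine hasSum_hc z (x i) ?_
      simpa [abs_of_pos (hx0 i)] using hzx i
    · simp_rw [avg_identity w q (by omega) D hD hDc z]
      have hS : Tendsto (fun n => (Finset.range (n + 1)).biUnion D) atTop atTop := by
        refine tendsto_atTop_finset_of_monotone ?_ ?_
        · intro m n hmn
          exact Finset.biUnion_subset_biUnion_of_subset_left _
            (Finset.range_subset_range.2 (by omega))
        · intro e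
          refine ⟨wdeg w e, Finset.mem_biUnion.2 ⟨wdeg w e, by simp, (hD _ _).2 rfl⟩⟩
      have hh := hsum'.hasSum
      simp only [HasSum, SummationFilter.unconditional_filter] at hh
      exact hh.comp hS

lemma coeff_sum {J : Type*} (S : Finset J) (ex : J → ℕ) (z : ℂ) (Q : ℂ) :
    HasSum (fun k => ((S.filter fun s => ex s = k).card : ℂ) / Q * z ^ k)
      ((∑ s ∈ S, z ^ ex s) / Q) := by
  classical
  rw [← Finset.sum_fiberwise_of_maps_to (t := S.image ex) (g := ex)
    (fun i hi => Finset.mem_image_of_mem ex hi), Finset.sum_div]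
  have : ∀ k, (∑ s ∈ S with ex s = k, z ^ ex s) / Q =
      ((S.filter fun s => ex s = k).card : ℂ) / Q * z ^ k := by
    intro k
    rw [Finset.sum_congr rfl (g := fun _ => z ^ k)
      (fun s hs => by rw [(Finset.mem_filter.1 hs).2])]
    simp; ring
  simp_rw [this]
  refine hasSum_sum_of_ne_finset_zero fun k hk => ?_
  rw [Finset.card_eq_zero.2]
  · simp
  · rw [Finset.filter_eq_empty_iff]
    intro s hs h
    exact hk (h ▸ Finset.mem_image_of_mem ex hs)

lemma abstract_final {I : Type*} (w : I → ℕ) (hw : ∀ i, 1 ≤ w i) (q : ℕ) (hq : 2 ≤ q)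
    (D : ℕ → Finset (I →₀ ℕ))
    (hD : ∀ n e, e ∈ D n ↔ wdeg w e = n) (hDc : ∀ n, (D n).card = q ^ n)
    (c : ℕ → ℕ → ℕ)
    (hcc : ∀ n k, c n k = ((D n).filter fun s => (s.sum fun _ j => j - 1) = k).card)
    (d : ℕ → ℝ)
    (hd : ∀ k, Tendsto (fun n : ℕ => (c n k : ℝ) / (q : ℝ) ^ n) atTop (𝓝 (d k)))
    (z : ℂ) (hz : ‖z‖ < Real.sqrt q) :
    (Summable fun i => ‖(1 - 1 / (q : ℂ) ^ w i) * (1 + 1 / ((q : ℂ) ^ w i - z)) - 1‖) ∧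
    Multipliable (fun i => (1 - 1 / (q : ℂ) ^ w i) * (1 + 1 / ((q : ℂ) ^ w i - z))) ∧
    HasSum (fun k : ℕ => (d k : ℂ) * z ^ k)
      (∏' i, (1 - 1 / (q : ℂ) ^ w i) * (1 + 1 / ((q : ℂ) ^ w i - z))) := by
  have hq1 : (1 : ℝ) < q := by exact_mod_cast hq
  have hq0 : (0 : ℝ) < q := by linarith
  set r := Real.sqrt q with hr
  have hr0 : 0 < r := Real.sqrt_pos.2 hq0
  have hrq : r < q := by
    rw [hr, Real.sqrt_lt' hq0]; nlinarith
  obtain ⟨h1, L, hL, hlim⟩ := abstract_main w hw q hq D hD hDc z (hz.trans hrq)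
  refine ⟨h1, hL.multipliable, ?_⟩
  rw [hL.tprod_eq]
  have hsumn : ∀ (y : ℂ) n, HasSum (fun k => (c n k : ℂ) / (q : ℂ) ^ n * y ^ k)
      ((∑ s ∈ D n, y ^ (s.sum fun _ j => j - 1)) / (q : ℂ) ^ n) := by
    intro y n
    simp_rw [hcc]
    exact coeff_sum (D n) _ y _
  obtain ⟨-, L', -, hlim'⟩ := abstract_main w hw q hq D hD hDc (r : ℂ)
    (by simpa [abs_of_pos hr0] using hrq)
  obtain ⟨C, hC⟩ := hlim'.norm.bddAbove_range
  have hbound : ∀ n k, (c n k : ℝ) / (q : ℝ) ^ n * r ^ k ≤ C := by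
    intro n k
    have hre : HasSum (fun k => (c n k : ℝ) / (q : ℝ) ^ n * r ^ k)
        ((∑ s ∈ D n, r ^ (s.sum fun _ j => j - 1)) / (q : ℝ) ^ n) := by
      have := hsumn (r : ℂ) n
      rw [← Complex.hasSum_ofReal]
      push_cast
      exact this
    refine (le_hasSum hre k fun j _ => by positivity).trans ?_
    have := hC ⟨n, rfl⟩
    refine le_trans (le_of_eq ?_) this
    have hpos : 0 ≤ (∑ s ∈ D n, r ^ (s.sum fun _ j => j - 1)) / (q : ℝ) ^ n := by positivity
    rw [← Real.norm_of_nonneg hpos, ← Complex.norm_real]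
    push_cast
    rfl
  have hgeo : Summable fun k => C * (‖z‖ / r) ^ k :=
    (summable_geometric_of_lt_one (by positivity) ((div_lt_one hr0).2 hz)).mul_left _
  have hbd : ∀ n k, ‖(c n k : ℂ) / (q : ℂ) ^ n * z ^ k‖ ≤ C * (‖z‖ / r) ^ k := by
    intro n k
    simp only [norm_mul, norm_div, norm_pow, Complex.norm_natCast]
    calc (c n k : ℝ) / (q : ℝ) ^ n * ‖z‖ ^ k
        = ((c n k : ℝ) / (q : ℝ) ^ n * r ^ k) * (‖z‖ / r) ^ k := by
          rw [div_pow]; field_simp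
      _ ≤ _ := by gcongr; exact hbound n k
  have hdc : ∀ k, Tendsto (fun n : ℕ => (c n k : ℂ) / (q : ℂ) ^ n * z ^ k) atTop
      (𝓝 ((d k : ℂ) * z ^ k)) := by
    intro k
    refine Tendsto.mul_const _ ?_
    have := (Complex.continuous_ofReal.tendsto (d k)).comp (hd k)
    refine this.congr fun n => ?_
    simp
  have hS : Summable fun k => (d k : ℂ) * z ^ k :=
    hgeo.of_norm_bounded fun k => le_of_tendsto (hdc k).norm (Eventually.of_forall fun n => hbd n k)
  have hT := tendsto_tsum_of_dominated_convergence hgeo hdc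
    (Eventually.of_forall fun n k => hbd n k)
  have hT' : Tendsto (fun n => (∑ s ∈ D n, z ^ (s.sum fun _ j => j - 1)) / (q : ℂ) ^ n) atTop
      (𝓝 (∑' k, (d k : ℂ) * z ^ k)) := hT.congr fun n => (hsumn z n).tsum_eq
  rw [tendsto_nhds_unique hlim hT']
  exact hS.hasSum

section PolyPart

open UniqueFactorizationMonoid

/-- Monic irreducible polynomials. -/
abbrev MIrr (Fq : Type*) [Field Fq] : Type _ := {π : Polynomial Fq // π.Monic ∧ Irreducible π}

/-- The monic polynomial with a given exponent vector. -/
noncomputable def toP {Fq : Type*} [Field Fq] (e : MIrr Fq →₀ ℕ) : Polynomial Fq :=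
  ((Finsupp.toMultiset e).map Subtype.val).prod

lemma toP_monic {Fq : Type*} [Field Fq] (e : MIrr Fq →₀ ℕ) : (toP e).Monic :=
  monic_multiset_prod_of_monic _ _ fun i _ => i.2.1

lemma toP_natDegree {Fq : Type*} [Field Fq] (e : MIrr Fq →₀ ℕ) :
    (toP e).natDegree = wdeg (fun π : MIrr Fq => π.1.natDegree) e := by
  rw [toP, natDegree_multiset_prod_of_monic, Multiset.map_map, wdeg]
  · rw [Finsupp.toMultiset_map, Finsupp.sum_toMultiset,
      Finsupp.sum_mapDomain_index (by simp) (by intros; ring)]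
    rfl
  · intro f hf
    obtain ⟨i, -, rfl⟩ := Multiset.mem_map.1 hf
    exact i.2.1

open scoped Classical in
lemma toP_factors {Fq : Type*} [Field Fq] (e : MIrr Fq →₀ ℕ) :
    normalizedFactors (toP e) = (Finsupp.toMultiset e).map Subtype.val := by
  rw [toP, normalizedFactors_prod_eq]
  · rw [Multiset.map_map]
    refine Multiset.map_congr rfl fun i _ => ?_
    exact i.2.1.normalize_eq_self
  · intro f hf
    obtain ⟨i, -, rfl⟩ := Multiset.mem_map.1 hf
    exact i.2.2

lemma toP_injective {Fq : Type*} [Field Fq] : Function.Injective (toP (Fq := Fq)) := by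
  classical
  intro e f h
  have h2 : normalizedFactors (toP e) = normalizedFactors (toP f) := by rw [h]
  rw [toP_factors, toP_factors] at h2
  have h3 := Multiset.map_injective Subtype.val_injective h2
  rw [← Finsupp.toMultiset_toFinsupp e, h3, Finsupp.toMultiset_toFinsupp]

lemma toP_surj {Fq : Type*} [Field Fq] (f : Polynomial Fq) (hf : f.Monic) : ∃ e, toP e = f := by
  classical
  have h1 : (normalizedFactors f).prod = f := by
    rw [prod_normalizedFactors_eq, hf.normalize_eq_self]
    exact hf.ne_zero
  have h2 : ∀ p ∈ normalizedFactors f, p.Monic ∧ Irreducible p := by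
    intro p hp
    have hi := irreducible_of_normalized_factor p hp
    exact ⟨(normalize_eq_self_iff_monic hi.ne_zero).1 (normalize_normalized_factor p hp), hi⟩
  generalize normalizedFactors f = m at h1 h2
  lift m to Multiset (MIrr Fq) using h2
  refine ⟨Multiset.toFinsupp m, ?_⟩
  rw [toP, Multiset.toFinsupp_toMultiset]
  exact h1

lemma toP_excess {Fq : Type*} [Field Fq] (e : MIrr Fq →₀ ℕ) :
    excess (toP e) = e.sum fun _ j => j - 1 := by
  classical
  have h1 : excess (toP e) = ((Finsupp.toMultiset e).map Subtype.val).card -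
      ((Finsupp.toMultiset e).map Subtype.val).toFinset.card := by
    rw [excess]
    convert rfl using 3
    · rw [toP_factors]
    · rw [toP_factors]
  rw [h1, Multiset.card_map, Multiset.toFinset_map,
    Finset.card_image_of_injective _ Subtype.val_injective, Finsupp.toFinset_toMultiset,
    Finsupp.card_toMultiset]
  simp only [Finsupp.sum, id]
  rw [Finset.sum_tsub_distrib, Finset.card_eq_sum_ones]
  intro i hi
  have := Finsupp.mem_support_iff.1 hi
  omega

lemma monic_set_eq {Fq : Type*} [Field Fq] (n : ℕ) :
    toP '' {e : MIrr Fq →₀ ℕ | wdeg (fun π : MIrr Fq => π.1.natDegree) e = n} =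
      {f : Polynomial Fq | f.Monic ∧ f.natDegree = n} := by
  ext f
  constructor
  · rintro ⟨e, he, rfl⟩
    exact ⟨toP_monic e, (toP_natDegree e).trans he⟩
  · rintro ⟨h1, h2⟩
    obtain ⟨e, rfl⟩ := toP_surj f h1
    exact ⟨e, (toP_natDegree e).symm.trans h2, rfl⟩

lemma monic_count (Fq : Type*) [Field Fq] [Fintype Fq] (n : ℕ) :
    {f : Polynomial Fq | f.Monic ∧ f.natDegree = n}.Finite ∧
    {f : Polynomial Fq | f.Monic ∧ f.natDegree = n}.ncard = Fintype.card Fq ^ n := by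
  have E := (monicEquivDegreeLT (R := Fq) n).trans (degreeLTEquiv Fq n).toEquiv
  constructor
  · exact Finite.of_equiv _ E.symm
  · have := Nat.card_congr E
    simp at this
    exact this

end PolyPart

theorem renyi_generating_function (q : ℕ) (hq : 2 ≤ q) (Fq : Type*) [Field Fq] [Fintype Fq]
    (hcard : Fintype.card Fq = q) (d : ℕ → ℝ)
    (hd : ∀ k, Tendsto (fun n : ℕ => (excessCount Fq n k : ℝ) / (q : ℝ) ^ n) atTop (𝓝 (d k)))
    (z : ℂ) (hz : ‖z‖ < Real.sqrt q) :
    Summable (fun π : {π : Polynomial Fq // π.Monic ∧ Irreducible π} =>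
      ‖(1 - 1 / (q : ℂ) ^ π.1.natDegree) * (1 + 1 / ((q : ℂ) ^ π.1.natDegree - z)) - 1‖) ∧
    Multipliable (fun π : {π : Polynomial Fq // π.Monic ∧ Irreducible π} =>
      (1 - 1 / (q : ℂ) ^ π.1.natDegree) * (1 + 1 / ((q : ℂ) ^ π.1.natDegree - z))) ∧
    HasSum (fun k : ℕ => (d k : ℂ) * z ^ k)
      (∏' π : {π : Polynomial Fq // π.Monic ∧ Irreducible π},
        (1 - 1 / (q : ℂ) ^ π.1.natDegree) * (1 + 1 / ((q : ℂ) ^ π.1.natDegree - z))) := by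
  classical
  have hfin : ∀ n, {e : MIrr Fq →₀ ℕ | wdeg (fun π : MIrr Fq => π.1.natDegree) e = n}.Finite := by
    intro n
    refine Set.Finite.of_finite_image ?_ toP_injective.injOn
    rw [monic_set_eq]
    exact (monic_count Fq n).1
  refine abstract_final (fun π : MIrr Fq => π.1.natDegree) (fun π => π.2.2.natDegree_pos) q hq
    (fun n => (hfin n).toFinset) (fun n e => by simp) (fun n => ?_) (excessCount Fq)
    (fun n k => ?_) d hd z hz
  · rw [← Set.ncard_eq_toFinset_card _ (hfin n), ← Set.ncard_image_of_injective _ toP_injective,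
      monic_set_eq, (monic_count Fq n).2, hcard]
  · rw [excessCount, ← Set.ncard_coe_finset, ← Set.ncard_image_of_injective _ toP_injective]
    congr 1
    ext f
    simp only [Set.mem_ofPred_eq, Set.mem_image, Finset.mem_coe, Finset.mem_filter,
      Set.Finite.mem_toFinset]
    constructor
    · rintro ⟨h1, h2, h3⟩
      obtain ⟨e, rfl⟩ := toP_surj f h1
      exact ⟨e, ⟨(toP_natDegree e).symm.trans h2, (toP_excess e).symm.trans h3⟩, rfl⟩
    · rintro ⟨e, ⟨h2, h3⟩, rfl⟩
      exact ⟨toP_monic e, (toP_natDegree e).trans h2, (toP_excess e).trans h3⟩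
end

section
/- Let q ≥ 2, let F_q be a finite field with q elements, and let ν_i be the number of monic irreducible polynomials of degree i over F_q. For every complex number t with |t| < 1/q, the infinite product ∏_{i≥1} (1 − t^i)^{ν_i} converges absolutely and equals 1 − q·t. -/
open Polynomial Filter Topology

section Helpers

variable {Fq : Type*} [Field Fq]

/-- Number of monic polynomials of degree `n`. -/
theorem aux_natCard [Fintype Fq] (n : ℕ) :
    Nat.card {p : Fq[X] // p.Monic ∧ p.natDegree = n} = Fintype.card Fq ^ n := by
  rw [Nat.card_congr ((monicEquivDegreeLT n).trans (degreeLTEquiv Fq n).toEquiv)]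
  simp

theorem aux_finite [Fintype Fq] (n : ℕ) :
    Finite {p : Fq[X] // p.Monic ∧ p.natDegree = n} :=
  Finite.of_equiv _ ((monicEquivDegreeLT n).trans (degreeLTEquiv Fq n).toEquiv).symm

theorem aux_nu_set_finite [Fintype Fq] (n : ℕ) :
    {p : Fq[X] | p.Monic ∧ Irreducible p ∧ p.natDegree = n}.Finite := by
  have h : {p : Fq[X] | p.Monic ∧ p.natDegree = n}.Finite := aux_finite n
  exact h.subset fun p hp => ⟨hp.1, hp.2.2⟩

theorem aux_nu_le [Fintype Fq] (n : ℕ) : nu Fq n ≤ Fintype.card Fq ^ n := by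
  have h : {p : Fq[X] | p.Monic ∧ p.natDegree = n}.Finite := aux_finite n
  rw [← aux_natCard n]
  exact Set.ncard_le_ncard (fun p hp => ⟨hp.1, hp.2.2⟩) h

/-- Monic polynomials, indexed by degree. -/
noncomputable def auxEquiv :
    (Σ n : ℕ, {p : Fq[X] // p.Monic ∧ p.natDegree = n}) ≃ {f : Fq[X] // f.Monic} where
  toFun x := ⟨x.2.1, x.2.2.1⟩
  invFun f := ⟨f.1.natDegree, f.1, f.2, rfl⟩
  left_inv := by rintro ⟨n, p, hp, rfl⟩; rfl
  right_inv f := rfl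

theorem aux_tsum_fiber {E : Type*} [NormedField E] [Fintype Fq] (n : ℕ) (t : E) :
    ∑' y : {p : Fq[X] // p.Monic ∧ p.natDegree = n}, t ^ (auxEquiv ⟨n, y⟩).1.natDegree
      = (Fintype.card Fq * t) ^ n := by
  have h : ∀ y : {p : Fq[X] // p.Monic ∧ p.natDegree = n},
      t ^ (auxEquiv ⟨n, y⟩).1.natDegree = t ^ n := fun y => by
    change t ^ y.1.natDegree = _
    rw [y.2.2]
  simp only [h, tsum_const, aux_natCard]
  simp [mul_pow]

theorem aux_summable_norm [Fintype Fq] (t : ℂ) (ht : Fintype.card Fq * ‖t‖ < 1) :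
    Summable (fun f : {f : Fq[X] // f.Monic} => ‖t ^ f.1.natDegree‖) := by
  rw [← auxEquiv.summable_iff]
  refine (summable_sigma_of_nonneg fun x => norm_nonneg _).2 ⟨fun n => ?_, ?_⟩
  · have := aux_finite (Fq := Fq) n
    exact Summable.of_finite
  · simp only [Function.comp_apply, norm_pow, aux_tsum_fiber]
    exact summable_geometric_of_lt_one (by positivity) ht

theorem aux_tsum [Fintype Fq] (t : ℂ) (ht : Fintype.card Fq * ‖t‖ < 1) :
    ∑' f : {f : Fq[X] // f.Monic}, t ^ f.1.natDegree = (1 - Fintype.card Fq * t)⁻¹ := by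
  have hs := (aux_summable_norm t ht).of_norm
  rw [← auxEquiv.tsum_eq]
  refine (Summable.tsum_sigma (auxEquiv.summable_iff.mpr hs)).trans ?_
  simp only [Function.comp_apply, aux_tsum_fiber]
  exact tsum_geometric_of_norm_lt_one (by simpa using ht)

theorem aux_sieve [Fintype Fq] (t : ℂ) (ht : Fintype.card Fq * ‖t‖ < 1)
    (S : Finset Fq[X]) (hS : ∀ p ∈ S, p.Monic ∧ Irreducible p) :
    ∑' f : {f : Fq[X] // f.Monic},
      Set.indicator {f : {f : Fq[X] // f.Monic} | ∀ p ∈ S, ¬ p ∣ f.1}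
        (fun f => t ^ f.1.natDegree) f
      = (1 - Fintype.card Fq * t)⁻¹ * ∏ p ∈ S, (1 - t ^ p.natDegree) := by
  classical
  induction S using Finset.induction_on with
  | empty => simpa using aux_tsum t ht
  | insert p S hp ih =>
    have hs := (aux_summable_norm (Fq := Fq) t ht).of_norm
    have ih := ih fun r hr => hS r (Finset.mem_insert_of_mem hr)
    obtain ⟨hpm, hpi⟩ := hS p (Finset.mem_insert_self _ _)
    rw [Finset.prod_insert hp]
    set A : Set {f : Fq[X] // f.Monic} := {f | ∀ p ∈ S, ¬ p ∣ f.1} with hA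
    set B : Set {f : Fq[X] // f.Monic} := {f | p ∣ f.1} with hB
    set g : {f : Fq[X] // f.Monic} → ℂ := fun f => t ^ f.1.natDegree with hg
    have hset : {f : {f : Fq[X] // f.Monic} | ∀ r ∈ insert p S, ¬ r ∣ f.1} = A \ B := by
      ext f
      simp [hA, hB, and_comm]
    have hdiff : ∀ f, (A \ B).indicator g f = A.indicator g f - (A ∩ B).indicator g f := by
      intro f
      by_cases h1 : f ∈ A <;> by_cases h2 : f ∈ B <;> simp [Set.indicator, h1, h2]
    rw [hset]
    simp only [hdiff]
    rw [Summable.tsum_sub (hs.indicator _) (hs.indicator _), ih]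
    let m : {f : Fq[X] // f.Monic} → {f : Fq[X] // f.Monic} :=
      fun f => ⟨p * f.1, hpm.mul f.2⟩
    have hm : Function.Injective m := by
      intro a b hab
      have : p * a.1 = p * b.1 := congrArg Subtype.val hab
      exact Subtype.ext (mul_left_cancel₀ hpi.ne_zero this)
    have hsupp : Function.support ((A ∩ B).indicator g) ⊆ Set.range m := by
      intro f hf
      have hf2 : f ∈ A ∩ B := Set.support_indicator_subset hf
      obtain ⟨c, hc⟩ := hf2.2
      refine ⟨⟨c, hpm.of_mul_monic_left (hc ▸ f.2)⟩, Subtype.ext hc.symm⟩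
    rw [← hm.tsum_eq hsupp]
    have hterm : ∀ c, (A ∩ B).indicator g (m c) = t ^ p.natDegree * A.indicator g c := by
      intro c
      have hmem : m c ∈ A ∩ B ↔ c ∈ A := by
        have hb : m c ∈ B := dvd_mul_right _ _
        simp only [Set.mem_inter_iff, hb, and_true]
        refine forall₂_congr fun r hr => not_congr ?_
        obtain ⟨hrm, hri⟩ := hS r (Finset.mem_insert_of_mem hr)
        change r ∣ p * c.1 ↔ _
        rw [hri.prime.dvd_mul]
        refine or_iff_right fun h => ?_
        have : r = p := eq_of_monic_of_associated hrm hpm (hri.associated_of_dvd hpi h)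
        exact hp (this ▸ hr)
      have hgm : g (m c) = t ^ p.natDegree * g c := by
        change t ^ (p * c.1).natDegree = _
        rw [hpm.natDegree_mul c.2, pow_add]
      by_cases h : c ∈ A
      · rw [Set.indicator_of_mem (hmem.2 h), Set.indicator_of_mem h, hgm]
      · rw [Set.indicator_of_notMem (fun h2 => h (hmem.1 h2)), Set.indicator_of_notMem h, mul_zero]
    simp only [hterm]
    rw [tsum_mul_left, ih]
    ring

theorem aux_tendsto [Fintype Fq] (t : ℂ) (ht : Fintype.card Fq * ‖t‖ < 1) :
    Tendsto (fun N : ℕ => ∏ i ∈ Finset.range N, (1 - t ^ (i + 1)) ^ nu Fq (i + 1)) atTop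
      (𝓝 (1 - Fintype.card Fq * t)) := by
  classical
  let P : ℕ → Finset Fq[X] := fun i => (aux_nu_set_finite (Fq := Fq) (i + 1)).toFinset
  have hP : ∀ i p, p ∈ P i ↔ p.Monic ∧ Irreducible p ∧ p.natDegree = i + 1 := by
    intro i p; simp [P]
  let S : ℕ → Finset Fq[X] := fun N => (Finset.range N).biUnion P
  have hS : ∀ N, ∀ p ∈ S N, p.Monic ∧ Irreducible p := by
    intro N p hp
    obtain ⟨i, -, hi⟩ := Finset.mem_biUnion.1 hp
    exact ⟨((hP i p).1 hi).1, ((hP i p).1 hi).2.1⟩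
  have hprod : ∀ N, ∏ p ∈ S N, (1 - t ^ p.natDegree)
      = ∏ i ∈ Finset.range N, (1 - t ^ (i + 1)) ^ nu Fq (i + 1) := by
    intro N
    rw [Finset.prod_biUnion]
    · refine Finset.prod_congr rfl fun i _ => ?_
      rw [Finset.prod_congr rfl (g := fun _ => 1 - t ^ (i + 1))
        (fun p hp => by rw [((hP i p).1 hp).2.2]), Finset.prod_const, nu,
        Set.ncard_eq_toFinset_card _ (aux_nu_set_finite (Fq := Fq) (i + 1))]
    · intro i _ j _ hij
      refine Finset.disjoint_left.2 fun p hpi hpj => hij ?_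
      have h1 := ((hP i p).1 hpi).2.2
      have h2 := ((hP j p).1 hpj).2.2
      omega
  have hne : (1 - Fintype.card Fq * t : ℂ) ≠ 0 := by
    intro h
    have h1 : (Fintype.card Fq * t : ℂ) = 1 := (sub_eq_zero.1 h).symm
    have h2 := congrArg norm h1
    simp only [norm_mul, Complex.norm_natCast, norm_one] at h2
    linarith
  have hlim : Tendsto (fun N => ∑' f : {f : Fq[X] // f.Monic},
      Set.indicator {f : {f : Fq[X] // f.Monic} | ∀ p ∈ S N, ¬ p ∣ f.1}
        (fun f => t ^ f.1.natDegree) f) atTop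
      (𝓝 (∑' f : {f : Fq[X] // f.Monic}, if f = ⟨1, monic_one⟩ then (1 : ℂ) else 0)) := by
    refine tendsto_tsum_of_dominated_convergence (aux_summable_norm (Fq := Fq) t ht) ?_ ?_
    · intro f
      refine tendsto_const_nhds.congr' ?_
      by_cases hf : f = ⟨1, monic_one⟩
      · subst hf
        refine Eventually.of_forall fun N => ?_
        beta_reduce
        rw [Set.indicator_of_mem]
        · simp
        · intro p hp hd
          exact (hS N p hp).2.not_isUnit (isUnit_of_dvd_one hd)
      · have hf1 : ¬ IsUnit f.1 := fun hu => hf (Subtype.ext (f.2.eq_one_of_isUnit hu))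
        obtain ⟨p, hpm, hpi, hpd⟩ := Polynomial.exists_monic_irreducible_factor f.1 hf1
        filter_upwards [eventually_ge_atTop p.natDegree] with N hN
        rw [if_neg hf, Set.indicator_of_notMem]
        intro h
        have hpos := hpm.natDegree_pos_of_not_isUnit hpi.not_isUnit
        refine h p (Finset.mem_biUnion.2 ⟨p.natDegree - 1, Finset.mem_range.2 (by omega),
          (hP _ p).2 ⟨?_, ?_, by omega⟩⟩) hpd
        · assumption
        · assumption
    · exact Eventually.of_forall fun N f => norm_indicator_le_norm_self _ _
  rw [tsum_ite_eq] at hlim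
  have := hlim.const_mul (1 - Fintype.card Fq * t : ℂ)
  rw [mul_one] at this
  refine this.congr fun N => ?_
  rw [aux_sieve t ht (S N) (hS N), hprod, mul_inv_cancel_left₀ hne]

theorem aux_summable [Fintype Fq] (t : ℂ) (ht : Fintype.card Fq * ‖t‖ < 1) :
    Summable (fun i : ℕ => ‖(1 - t ^ (i + 1)) ^ nu Fq (i + 1) - 1‖) := by
  have hg : Summable fun i : ℕ => 2 * (Fintype.card Fq * ‖t‖) ^ (i + 1) :=
    ((summable_nat_add_iff 1).2 (summable_geometric_of_lt_one (by positivity) ht)).mul_left 2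
  refine Summable.of_nonneg_of_le (fun _ => norm_nonneg _) (fun i => ?_) hg
  have h1 := (Finset.range (nu Fq (i + 1))).norm_prod_one_add_sub_one_le
    (fun _ => -t ^ (i + 1))
  simp only [Finset.prod_const, Finset.card_range, ← sub_eq_add_neg, norm_neg, norm_pow,
    Finset.sum_const, nsmul_eq_mul] at h1
  have h2 : (nu Fq (i + 1) : ℝ) * ‖t‖ ^ (i + 1) ≤ (Fintype.card Fq * ‖t‖) ^ (i + 1) := by
    rw [mul_pow]
    gcongr
    exact_mod_cast aux_nu_le (Fq := Fq) (i + 1)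
  have h3 : (Fintype.card Fq * ‖t‖) ^ (i + 1) ≤ 1 := pow_le_one₀ (by positivity) ht.le
  have h0 : 0 ≤ (nu Fq (i + 1) : ℝ) * ‖t‖ ^ (i + 1) := by positivity
  have h4 := Real.abs_exp_sub_one_le (x := (nu Fq (i + 1) : ℝ) * ‖t‖ ^ (i + 1))
    (by rw [abs_of_nonneg h0]; linarith)
  rw [abs_of_nonneg h0] at h4
  linarith [le_abs_self (Real.exp ((nu Fq (i + 1) : ℝ) * ‖t‖ ^ (i + 1)) - 1)]

end Helpers

/-- for `|t| < 1/q`, the product `∏_{i≥1} (1 - t^i)^{ν_i}` converges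
absolutely and equals `1 - q·t`. -/
theorem prime_product_identity (q : ℕ) (hq : 2 ≤ q) (Fq : Type*) [Field Fq] [Fintype Fq]
    (hcard : Fintype.card Fq = q) (t : ℂ) (ht : ‖t‖ < 1 / q) :
    Summable (fun i : ℕ => ‖(1 - t ^ (i + 1)) ^ nu Fq (i + 1) - 1‖) ∧
    HasProd (fun i : ℕ => (1 - t ^ (i + 1)) ^ nu Fq (i + 1)) (1 - q * t) := by
  subst hcard
  have hq0 : (0 : ℝ) < Fintype.card Fq := by exact_mod_cast (by omega : 0 < Fintype.card Fq)
  have ht' : Fintype.card Fq * ‖t‖ < 1 := by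
    rw [lt_div_iff₀ hq0] at ht
    linarith
  have hs := aux_summable (Fq := Fq) t ht'
  refine ⟨hs, ?_⟩
  have hm : Multipliable (fun i : ℕ => (1 - t ^ (i + 1)) ^ nu Fq (i + 1)) := by
    have := multipliable_one_add_of_summable hs
    simpa using this
  exact (Multipliable.hasProd_iff_tendsto_nat hm).2 (aux_tendsto t ht')
end

section
/- Let q ≥ 2 and let F_q be a finite field with q elements. For every complex number t with |t| < 1/q, the infinite product over all monic irreducible polynomials π in F_q[x] of 1/(1 − t^{deg π}) converges absolutely and equals 1/(1 − q·t). -/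
open Polynomial Filter Topology

section helpers
open Finset

/-- Monic polynomials of degree `n` are counted by `q^n`. -/
lemma card_monic_fiber (Fq : Type*) [Field Fq] [Fintype Fq] (n : ℕ) :
    Nonempty ({f : {f : Polynomial Fq // f.Monic} // f.1.natDegree = n} ≃ (Fin n → Fq)) := by
  refine ⟨Equiv.trans ?_ ((monicEquivDegreeLT (R := Fq) n).trans (degreeLTEquiv Fq n).toEquiv)⟩
  exact
    { toFun := fun f => ⟨f.1.1, f.1.2, f.2⟩
      invFun := fun f => ⟨⟨f.1, f.2.1⟩, f.2.2⟩
      left_inv := fun f => rfl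
      right_inv := fun f => rfl }

lemma hasSum_monic_fiber (Fq : Type*) [Field Fq] [Fintype Fq] {K : Type*} [RCLike K] (s : K)
    (n : ℕ) :
    HasSum (fun f : {f : {f : Polynomial Fq // f.Monic} // f.1.natDegree = n} =>
      s ^ (f.1.1.natDegree)) (((Fintype.card Fq : K) * s) ^ n) := by
  obtain ⟨e'⟩ := card_monic_fiber Fq n
  have := Fintype.ofEquiv _ e'.symm
  have := hasSum_fintype (fun f : {f : {f : Polynomial Fq // f.Monic} // f.1.natDegree = n} =>
      s ^ (f.1.1.natDegree))
  convert this using 1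
  rw [Finset.sum_congr rfl (fun f _ => by rw [f.2])]
  simp [Fintype.card_congr e', mul_pow]

lemma hasSum_monic {𝕜 : Type*} [RCLike 𝕜] (Fq : Type*) [Field Fq] [Fintype Fq] (t : 𝕜)
    (ht : ‖(Fintype.card Fq : 𝕜) * t‖ < 1) :
    Summable (fun f : {f : Polynomial Fq // f.Monic} => ‖t ^ f.1.natDegree‖) ∧
    HasSum (fun f : {f : Polynomial Fq // f.Monic} => t ^ f.1.natDegree)
      (1 - (Fintype.card Fq : 𝕜) * t)⁻¹ := by
  let e := Equiv.sigmaFiberEquiv (fun f : {f : Polynomial Fq // f.Monic} => f.1.natDegree)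
  have hs : Summable (fun f : {f : Polynomial Fq // f.Monic} => ‖t ^ f.1.natDegree‖) := by
    rw [← e.summable_iff]
    refine (summable_sigma_of_nonneg (fun x => norm_nonneg (t ^ (e x).1.natDegree))).mpr ?_
    have key' := fun n => hasSum_monic_fiber Fq (K := ℝ) ‖t‖ n
    simp only [norm_pow]
    refine ⟨fun n => (key' n).summable, ?_⟩
    refine (summable_geometric_of_lt_one (r := (Fintype.card Fq : ℝ) * ‖t‖) (by positivity)
      (by simpa using ht)).congr fun n => ?_
    exact (key' n).tsum_eq.symm
  refine ⟨hs, ?_⟩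
  have h1 : Summable (fun f : {f : Polynomial Fq // f.Monic} => t ^ f.1.natDegree) := hs.of_norm
  have h2 := (e.hasSum_iff.mpr h1.hasSum).sigma (fun n => hasSum_monic_fiber Fq t n)
  rw [(hasSum_geometric_of_norm_lt_one ht).unique h2]
  exact h1.hasSum

open scoped Classical in
lemma sieve_step {Fq : Type*} [Field Fq] [Fintype Fq] (t : ℂ)
    (hs : Summable (fun f : {f : Polynomial Fq // f.Monic} => t ^ f.1.natDegree))
    (s : Finset {π : Polynomial Fq // π.Monic ∧ Irreducible π}) :
    ∑' f : {f : Polynomial Fq // f.Monic},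
      (if ∀ p ∈ s, ¬ p.1 ∣ f.1 then t ^ f.1.natDegree else 0) =
    (∏ p ∈ s, (1 - t ^ p.1.natDegree)) *
      ∑' f : {f : Polynomial Fq // f.Monic}, t ^ f.1.natDegree := by
  have hsum : ∀ (P : {f : Polynomial Fq // f.Monic} → Prop) [DecidablePred P],
      Summable (fun f : {f : Polynomial Fq // f.Monic} => if P f then t ^ f.1.natDegree else 0) := by
    intro P _
    exact (hs.indicator {f | P f}).congr fun f => by simp [Set.indicator_apply]
  induction s using Finset.induction_on with
  | empty => simp
  | insert a s ha ih =>
    rw [Finset.prod_insert ha, mul_assoc, ← ih, sub_mul, one_mul, eq_sub_iff_add_eq]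
    let g : {f : Polynomial Fq // f.Monic} → {f : Polynomial Fq // f.Monic} :=
      fun f => ⟨a.1 * f.1, a.2.1.mul f.2⟩
    have hg : Function.Injective g := by
      intro x y h
      have : a.1 * x.1 = a.1 * y.1 := congrArg Subtype.val h
      exact Subtype.ext (mul_left_cancel₀ a.2.1.ne_zero this)
    have h3 : t ^ a.1.natDegree * ∑' f : {f : Polynomial Fq // f.Monic},
          (if ∀ p ∈ s, ¬ p.1 ∣ f.1 then t ^ f.1.natDegree else 0) =
        ∑' f : {f : Polynomial Fq // f.Monic},
          (if (∀ p ∈ s, ¬ p.1 ∣ f.1) ∧ a.1 ∣ f.1 then t ^ f.1.natDegree else 0) := by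
      rw [← tsum_mul_left, ← hg.tsum_eq (f := fun f : {f : Polynomial Fq // f.Monic} =>
        (if (∀ p ∈ s, ¬ p.1 ∣ f.1) ∧ a.1 ∣ f.1 then t ^ f.1.natDegree else 0))]
      · refine tsum_congr fun f => ?_
        have hiff : (∀ p ∈ s, ¬ p.1 ∣ a.1 * f.1) ↔ (∀ p ∈ s, ¬ p.1 ∣ f.1) := by
          refine forall₂_congr fun p hp => not_congr ⟨fun h => ?_, fun h => h.mul_left _⟩
          rcases p.2.2.prime.dvd_or_dvd h with h | h
          · exfalso
            have h5 := p.2.2.associated_of_dvd a.2.2 h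
            have h6 := eq_of_monic_of_associated p.2.1 a.2.1 h5
            exact ha (Subtype.ext h6 ▸ hp)
          · exact h
        simp only [g, hiff, dvd_mul_right, and_true]
        rw [Monic.natDegree_mul a.2.1 f.2, pow_add]
        split_ifs <;> simp
      · intro f hf
        rw [Function.mem_support] at hf
        have : a.1 ∣ f.1 := by
          by_contra h
          simp [h] at hf
        obtain ⟨c, hc⟩ := this
        refine ⟨⟨c, a.2.1.of_mul_monic_left (hc ▸ f.2)⟩, Subtype.ext hc.symm⟩
    rw [h3, ← (hsum _).tsum_add (hsum _)]
    refine tsum_congr fun f => ?_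
    simp only [Finset.mem_insert, forall_eq_or_imp]
    by_cases h1 : a.1 ∣ f.1 <;> by_cases h2 : ∀ p ∈ s, ¬ p.1 ∣ f.1 <;> simp only [h1, h2] <;> simp

open scoped Classical in
lemma sieve_tendsto {Fq : Type*} [Field Fq] [Fintype Fq] (t : ℂ)
    (hs : Summable (fun f : {f : Polynomial Fq // f.Monic} => ‖t ^ f.1.natDegree‖)) :
    Tendsto (fun s : Finset {π : Polynomial Fq // π.Monic ∧ Irreducible π} =>
      ∑' f : {f : Polynomial Fq // f.Monic},
        (if ∀ p ∈ s, ¬ p.1 ∣ f.1 then t ^ f.1.natDegree else 0)) atTop (𝓝 1) := by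
  have h1 : ∑' f : {f : Polynomial Fq // f.Monic},
      (if f = ⟨1, monic_one⟩ then (1 : ℂ) else 0) = 1 := by
    rw [tsum_ite_eq]
  rw [← h1]
  refine tendsto_tsum_of_dominated_convergence hs (fun f => ?_)
    (Eventually.of_forall fun s f => ?_)
  · refine tendsto_const_nhds.congr' ?_
    by_cases hf : f = ⟨1, monic_one⟩
    · refine Eventually.of_forall fun s => ?_
      have : ∀ p ∈ s, ¬ p.1 ∣ f.1 := by
        intro p _ hp
        rw [hf] at hp
        exact p.2.2.not_isUnit (isUnit_of_dvd_one hp)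
      beta_reduce
      rw [if_pos this, if_pos hf, hf]
      simp
    · have hu : ¬ IsUnit f.1 := fun h => hf (Subtype.ext (f.2.isUnit_iff.mp h))
      obtain ⟨g, hgm, hgi, hgd⟩ := exists_monic_irreducible_factor f.1 hu
      filter_upwards [eventually_ge_atTop {⟨g, hgm, hgi⟩}] with s hsub
      have : ¬ ∀ p ∈ s, ¬ p.1 ∣ f.1 := fun h =>
        h ⟨g, hgm, hgi⟩ (hsub (Finset.mem_singleton_self _)) hgd
      rw [if_neg this, if_neg hf]
  · split_ifs <;> simp

end helpers

/-- for `|t| < 1/q`, the product over monic irreducible `π` of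
`1/(1 - t^{deg π})` converges absolutely and equals `1/(1 - q·t)`. -/
theorem euler_product_polynomials (q : ℕ) (hq : 2 ≤ q) (Fq : Type*) [Field Fq] [Fintype Fq]
    (hcard : Fintype.card Fq = q) (t : ℂ) (ht : ‖t‖ < 1 / q) :
    Summable (fun π : {π : Polynomial Fq // π.Monic ∧ Irreducible π} =>
      ‖(1 - t ^ π.1.natDegree)⁻¹ - 1‖) ∧
    HasProd (fun π : {π : Polynomial Fq // π.Monic ∧ Irreducible π} =>
      (1 - t ^ π.1.natDegree)⁻¹) (1 - q * t)⁻¹ := by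
  have hq0 : (0 : ℝ) < q := by positivity
  have hq2 : (2 : ℝ) ≤ q := by exact_mod_cast hq
  have hqt : q * ‖t‖ < 1 := by
    rw [lt_div_iff₀ hq0] at ht
    linarith
  have ht2 : ‖t‖ < 1 / 2 := lt_of_lt_of_le ht (by gcongr)
  obtain ⟨hs, hS⟩ := hasSum_monic (𝕜 := ℂ) Fq t (by rw [hcard]; simpa using hqt)
  rw [hcard] at hS
  have hz : ∀ π : {π : Polynomial Fq // π.Monic ∧ Irreducible π},
      ‖t ^ π.1.natDegree‖ ≤ 1 / 2 := by
    intro π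
    rw [norm_pow]
    calc ‖t‖ ^ π.1.natDegree ≤ ‖t‖ :=
          pow_le_of_le_one (norm_nonneg _) (by linarith) π.2.2.natDegree_pos.ne'
      _ ≤ 1 / 2 := ht2.le
  have hne : ∀ π : {π : Polynomial Fq // π.Monic ∧ Irreducible π},
      1 - t ^ π.1.natDegree ≠ 0 := by
    intro π h
    have h1 := hz π
    rw [← sub_eq_zero.mp h] at h1
    norm_num at h1
  have hirr : Summable (fun π : {π : Polynomial Fq // π.Monic ∧ Irreducible π} =>
      ‖t ^ π.1.natDegree‖) :=
    hs.comp_injective (i := fun π : {π : Polynomial Fq // π.Monic ∧ Irreducible π} =>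
      (⟨π.1, π.2.1⟩ : {f : Polynomial Fq // f.Monic}))
      (fun x y h => Subtype.ext (Subtype.mk.inj h))
  constructor
  · refine Summable.of_nonneg_of_le (fun _ => norm_nonneg _) (fun π => ?_) (hirr.mul_left 2)
    have h1 : (1 - t ^ π.1.natDegree)⁻¹ - 1 = t ^ π.1.natDegree * (1 - t ^ π.1.natDegree)⁻¹ := by
      field_simp [hne π]
      ring
    have h2 : 1 / 2 ≤ ‖1 - t ^ π.1.natDegree‖ := by
      have := norm_sub_norm_le 1 (t ^ π.1.natDegree)
      have h3 := hz π
      rw [norm_one] at this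
      linarith
    have h4 : ‖1 - t ^ π.1.natDegree‖⁻¹ ≤ 2 := by
      rw [inv_le_comm₀ (by linarith) (by norm_num)]
      linarith
    rw [h1, norm_mul, norm_inv, mul_comm]
    gcongr
  · have hT := ((sieve_tendsto t hs).inv₀ one_ne_zero).mul_const (1 - (q : ℂ) * t)⁻¹
    rw [inv_one, one_mul] at hT
    have hqne : (1 - (q : ℂ) * t) ≠ 0 := by
      intro h
      have h1 : ‖(q : ℂ) * t‖ = 1 := by rw [← sub_eq_zero.mp h, norm_one]
      rw [norm_mul, Complex.norm_natCast] at h1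
      linarith
    refine hT.congr fun s => ?_
    rw [sieve_step t hs.of_norm s, hS.tsum_eq, Finset.prod_inv_distrib, mul_inv, mul_assoc,
      inv_mul_cancel₀ (inv_ne_zero hqne), mul_one]
end
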